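/- arXiv:2203.11109 — 2 statements merged into one kernel-verified Lean document; each statement's English description precedes it below -/
import Mathlib

section
/- Let A be a finitely generated GPerm algebra and B = A/I the quotient by the ideal I generated by all commutators. Then B is a finitely generated commutative graded algebra, A_{≥1} is a finitely generated right B-module (via the quotient action, which is well-defined since A_{≥1}·I = 0 forces the right action of I on A_{≥1}/(A_{≥1}∩ left-killed part) to factor), and consequently A is right noetherian with rational Hilbert series. -/
/-- Modules over a finitely generated algebra acting by commuting operators. -/
theorem gp_noeth {k R M : Type*} [Field k] [Ring R] [Algebra k R] [AddCommGroup M] [Module k M]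
    [Module R M] [IsScalarTower k R M] (hfg : Algebra.FiniteType k R)
    (hcomm : ∀ (a b : R) (m : M), a • b • m = b • a • m) (hM : Module.Finite R M) :
    IsNoetherian R M := by
  have : SMulCommClass R k M := SMulCommClass.symm k R M
  let φ : R →ₐ[k] Module.End k M := Algebra.lsmul k k M
  let B := φ.range
  have hφ : ∀ (r : R) (m : M), φ r m = r • m := fun r m => rfl
  let _ : CommRing B :=
    { (inferInstance : Ring B) with
      mul_comm := by
        rintro ⟨_, a, rfl⟩ ⟨_, b, rfl⟩
        apply Subtype.ext
        ext m
        exact hcomm a b m }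
  have hB : Algebra.FiniteType k B :=
    Algebra.FiniteType.of_surjective φ.rangeRestrict φ.rangeRestrict_surjective
  have hBn : IsNoetherianRing B := Algebra.FiniteType.isNoetherianRing k B
  have hsm : ∀ (r : R) (m : M), (φ.rangeRestrict r) • m = r • m := fun r m => rfl
  have hMB : Module.Finite B M := by
    obtain ⟨S, hS⟩ := hM.fg_top
    refine ⟨⟨S, ?_⟩⟩
    rw [eq_top_iff]
    intro m _
    have hm : m ∈ Submodule.span R (S : Set M) := by rw [hS]; trivial
    induction hm using Submodule.span_induction with
    | mem x hx => exact Submodule.subset_span hx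
    | zero => exact Submodule.zero_mem _
    | add x y _ _ hx hy => exact Submodule.add_mem _ (hx trivial) (hy trivial)
    | smul a x _ hx =>
      rw [← hsm]
      exact Submodule.smul_mem _ _ (hx trivial)
  have hn : IsNoetherian B M := isNoetherian_of_isNoetherianRing_of_finite B M
  constructor
  intro N
  let N' : Submodule B M :=
    { carrier := N
      add_mem' := fun h1 h2 => N.add_mem h1 h2
      zero_mem' := N.zero_mem
      smul_mem' := by
        rintro ⟨_, a, rfl⟩ m hm
        exact N.smul_mem a hm }
  obtain ⟨S, hS⟩ := hn.noetherian N'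
  refine ⟨S, ?_⟩
  apply le_antisymm
  · rw [Submodule.span_le]
    intro x hx
    have : x ∈ N' := hS ▸ Submodule.subset_span hx
    exact this
  · intro m hm
    have hm : m ∈ Submodule.span B (S : Set M) := by rw [hS]; exact hm
    induction hm using Submodule.span_induction with
    | mem x hx => exact Submodule.subset_span hx
    | zero => exact Submodule.zero_mem _
    | add x y hx' hy' hx hy =>
      have h1 : x ∈ N' := hS ▸ hx'
      have h2 : y ∈ N' := hS ▸ hy'
      exact Submodule.add_mem _ (hx h1) (hy h2)
    | smul a x hx' hx =>
      have h1 : x ∈ N' := hS ▸ hx'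
      obtain ⟨_, a, rfl⟩ := a
      exact Submodule.smul_mem _ a (hx h1)

/-- Rationality of an integer sequence. -/
def GpRat (f : ℕ → ℤ) : Prop :=
  ∃ p q : Polynomial ℤ, q.coeff 0 = 1 ∧
      PowerSeries.mk f * (q : PowerSeries ℤ) = (p : PowerSeries ℤ)

theorem GpRat.add {f g : ℕ → ℤ} (hf : GpRat f) (hg : GpRat g) : GpRat (fun i => f i + g i) := by
  obtain ⟨p, q, h0, h⟩ := hf
  obtain ⟨p', q', h0', h'⟩ := hg
  refine ⟨p * q' + p' * q, q * q', by rw [Polynomial.mul_coeff_zero, h0, h0', mul_one], ?_⟩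
  have : PowerSeries.mk (fun i => f i + g i) = PowerSeries.mk f + PowerSeries.mk g := by
    ext; simp
  rw [this]
  push_cast
  rw [← h, ← h']
  ring

theorem GpRat.of_eventually {f : ℕ → ℤ} (E : ℕ) (hf : ∀ i, E < i → f i = 0) : GpRat f := by
  refine ⟨PowerSeries.trunc (E + 1) (PowerSeries.mk f), 1, by simp, ?_⟩
  ext i
  simp only [Polynomial.coe_one, mul_one, PowerSeries.coeff_mk, Polynomial.coeff_coe,
    PowerSeries.coeff_trunc]
  split_ifs with h
  · rfl
  · exact hf i (by omega)

theorem GpRat.step {f c g : ℕ → ℤ} (d : ℕ) (hd : 1 ≤ d) (hc : GpRat c) (hg : GpRat g)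
    (h1 : ∀ i, i < d → f i = c i) (h2 : ∀ i, f (i + d) - f i = c (i + d) - g i) : GpRat f := by
  obtain ⟨p, q, h0, h⟩ := hc
  obtain ⟨p', q', h0', h'⟩ := hg
  refine ⟨p * q' - Polynomial.X ^ d * p' * q, (1 - Polynomial.X ^ d) * (q * q'), ?_, ?_⟩
  · have : ¬ 0 = d := by omega
    simp [Polynomial.mul_coeff_zero, h0, h0', this]
  have key : PowerSeries.mk f * (1 - PowerSeries.X ^ d) =
      PowerSeries.mk c - PowerSeries.X ^ d * PowerSeries.mk g := by
    ext i
    rw [mul_sub, mul_one, mul_comm]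
    simp only [map_sub, PowerSeries.coeff_mk, PowerSeries.coeff_X_pow_mul']
    split_ifs with hi
    · obtain ⟨j, rfl⟩ := Nat.exists_eq_add_of_le hi
      have := h2 j
      rw [add_comm d j]
      simpa using this
    · simpa using h1 i (by omega)
  push_cast
  rw [← h, ← h', ← mul_assoc, key]
  ring

/-- The linear algebra behind the four-term exact sequence. -/
theorem gp_rank {k A : Type*} [Field k] [AddCommGroup A] [Module k A] (X : A →ₗ[k] A)
    (N P : Submodule k A) [FiniteDimensional k N] [FiniteDimensional k P] :
    (Module.finrank k N : ℤ) - Module.finrank k (N ⊓ P.comap X : Submodule k A) =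
      Module.finrank k (P ⊔ N.map X : Submodule k A) - Module.finrank k P := by
  have rn : ∀ (K : Submodule k A) [FiniteDimensional k K],
      Module.finrank k (K.map X : Submodule k A) +
        Module.finrank k (K ⊓ LinearMap.ker X : Submodule k A) = Module.finrank k K := by
    intro K _
    have h := LinearMap.finrank_range_add_finrank_ker (X.domRestrict K)
    rw [LinearMap.range_domRestrict, LinearMap.ker_domRestrict] at h
    have e : Module.finrank k (Submodule.comap K.subtype (LinearMap.ker X)) =
        Module.finrank k (K ⊓ LinearMap.ker X : Submodule k A) := by
      rw [← Submodule.map_comap_subtype]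
      exact (Submodule.finrank_map_subtype_eq _ _).symm
    rw [← e]
    exact h
  have hK : FiniteDimensional k (N ⊓ P.comap X : Submodule k A) :=
    Submodule.finiteDimensional_inf_left _ _
  have r1 := rn N
  have r2 := rn (N ⊓ P.comap X)
  have e1 : (N ⊓ P.comap X) ⊓ LinearMap.ker X = N ⊓ LinearMap.ker X := by
    ext a
    simp only [Submodule.mem_inf, Submodule.mem_comap, LinearMap.mem_ker]
    constructor
    · rintro ⟨⟨h, _⟩, h'⟩
      exact ⟨h, h'⟩
    · rintro ⟨h, h'⟩
      exact ⟨⟨h, by rw [h']; exact P.zero_mem⟩, h'⟩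
  have e2 : (N ⊓ P.comap X).map X = P ⊓ N.map X := by
    ext y
    constructor
    · rintro ⟨a, ⟨ha, ha'⟩, rfl⟩
      exact ⟨ha', a, ha, rfl⟩
    · rintro ⟨hy, a, ha, rfl⟩
      exact ⟨a, ⟨ha, hy⟩, rfl⟩
  rw [e1, e2] at r2
  have r3 := Submodule.finrank_sup_add_finrank_inf_eq P (N.map X)
  omega

section
variable {k A : Type*} [Field k] [Ring A] [Algebra k A] (𝒜 : ℕ → Submodule k A) [GradedAlgebra 𝒜]

/-- A homogeneous right ideal, given by its components. -/
def GpFam (N : ℕ → Submodule k A) : Prop :=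
  (∀ i, N i ≤ 𝒜 i) ∧ ∀ i j, ∀ a ∈ N i, ∀ b ∈ 𝒜 j, a * b ∈ N (i + j)

/-- The right ideal attached to a family. -/
def gpTot (N : ℕ → Submodule k A) (hN : GpFam 𝒜 N) : Submodule Aᵐᵒᵖ A where
  carrier := {a | ∀ i, (DirectSum.decompose 𝒜 a i : A) ∈ N i}
  add_mem' := by
    intro a b ha hb i
    rw [DirectSum.decompose_add]
    exact (N i).add_mem (ha i) (hb i)
  zero_mem' := by
    intro i
    rw [DirectSum.decompose_zero]
    exact (N i).zero_mem
  smul_mem' := by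
    intro c a ha i
    induction c using MulOpposite.rec' with
    | h b =>
    change (DirectSum.decompose 𝒜 (a * b) i : A) ∈ N i
    induction b using DirectSum.Decomposition.inductionOn 𝒜 with
    | zero => rw [mul_zero, DirectSum.decompose_zero]; exact (N i).zero_mem
    | @homogeneous j m =>
      rw [DirectSum.coe_decompose_mul_of_right_mem 𝒜 i m.2]
      split_ifs with h
      · have := hN.2 (i - j) j _ (ha (i - j)) m m.2
        rwa [Nat.sub_add_cancel h] at this
      · exact (N i).zero_mem
    | add x y hx hy =>
      rw [mul_add, DirectSum.decompose_add]
      exact (N i).add_mem hx hy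

theorem gp_mem_tot {N : ℕ → Submodule k A} (hN : GpFam 𝒜 N) {a : A} :
    a ∈ gpTot 𝒜 N hN ↔ ∀ i, (DirectSum.decompose 𝒜 a i : A) ∈ N i := Iff.rfl

theorem gp_mem_tot_hom {N : ℕ → Submodule k A} (hN : GpFam 𝒜 N) {a : A} {i : ℕ} (ha : a ∈ 𝒜 i) :
    a ∈ gpTot 𝒜 N hN ↔ a ∈ N i := by
  rw [gp_mem_tot]
  constructor
  · intro h
    have := h i
    rwa [DirectSum.decompose_of_mem_same 𝒜 ha] at this
  · intro h j
    by_cases hj : i = j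
    · subst hj
      rwa [DirectSum.decompose_of_mem_same 𝒜 ha]
    · rw [DirectSum.decompose_of_mem_ne 𝒜 ha hj]
      exact Submodule.zero_mem _

/-- base case -/
theorem gp_base (hn : IsNoetherian Aᵐᵒᵖ A) {N P : ℕ → Submodule k A} (hN : GpFam 𝒜 N)
    (hP : GpFam 𝒜 P) (hle : ∀ i, P i ≤ N i)
    (hkill : ∀ i j, 1 ≤ j → ∀ a ∈ N i, ∀ b ∈ 𝒜 j, a * b ∈ P (i + j)) :
    ∃ E, ∀ i, E < i → N i = P i := by
  let F : ℕ → ℕ → Submodule k A := fun E i => if i ≤ E then N i else P i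
  have hFle : ∀ E i, F E i ≤ N i := by
    intro E i
    simp only [F]
    split_ifs
    · exact le_rfl
    · exact hle i
  have hPF : ∀ E i, P i ≤ F E i := by
    intro E i
    simp only [F]
    split_ifs
    · exact hle i
    · exact le_rfl
  have hF : ∀ E, GpFam 𝒜 (F E) := by
    intro E
    refine ⟨fun i => (hFle E i).trans (hN.1 i), ?_⟩
    intro i j a ha b hb
    rcases Nat.eq_zero_or_pos j with rfl | hj
    · simp only [F, add_zero] at ha ⊢
      split_ifs with h
      · rw [if_pos h] at ha
        exact hN.2 i 0 a ha b hb
      · rw [if_neg h] at ha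
        exact hP.2 i 0 a ha b hb
    · exact hPF E _ (hkill i j hj a (hFle E i ha) b hb)
  let G : ℕ →o Submodule Aᵐᵒᵖ A :=
    { toFun := fun E => gpTot 𝒜 (F E) (hF E)
      monotone' := by
        intro E E' hE a ha i
        have h := ha i
        simp only [F] at h ⊢
        by_cases h1 : i ≤ E
        · rw [if_pos h1] at h
          rwa [if_pos (h1.trans hE)]
        · rw [if_neg h1] at h
          split_ifs
          · exact hle i h
          · exact h }
  obtain ⟨E, hE⟩ := monotone_stabilizes_iff_noetherian.mpr hn G
  refine ⟨E, fun i hi => le_antisymm ?_ (hle i)⟩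
  intro a ha
  have h1 : a ∈ G i := by
    refine (gp_mem_tot_hom 𝒜 (hF i) (hN.1 i ha)).mpr ?_
    simpa [F] using ha
  rw [← hE i hi.le] at h1
  have h2 := (gp_mem_tot_hom 𝒜 (hF E) (hN.1 i ha)).mp h1
  simpa [F, not_le.mpr hi] using h2

theorem gp_hs (hlf : ∀ i, FiniteDimensional k (𝒜 i)) (hn : IsNoetherian Aᵐᵒᵖ A)
    (S : Set (ℕ × A))
    (hS : ∀ N P : ℕ → Submodule k A, GpFam 𝒜 N → GpFam 𝒜 P →
      (∀ p ∈ S, ∀ i, ∀ a ∈ N i, a * p.2 ∈ P (i + p.1)) →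
      ∀ i j, 1 ≤ j → ∀ a ∈ N i, ∀ b ∈ 𝒜 j, a * b ∈ P (i + j))
    (l : List (ℕ × A)) (hl : ∀ p ∈ l, 1 ≤ p.1 ∧ p.2 ∈ 𝒜 p.1) :
    ∀ (N P : ℕ → Submodule k A), GpFam 𝒜 N → GpFam 𝒜 P → (∀ i, P i ≤ N i) →
      (∀ i, ∀ a ∈ N i, ∀ b c : A, a * (b * c) = a * (c * b)) →
      (∀ p ∈ S, p ∈ l ∨ ∀ i, ∀ a ∈ N i, a * p.2 ∈ P (i + p.1)) →
      GpRat (fun i => (Module.finrank k (N i) : ℤ) - Module.finrank k (P i)) := by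
  induction l with
  | nil =>
    intro N P hN hP hle _ hk
    obtain ⟨E, hE⟩ := gp_base 𝒜 hn hN hP hle
      (hS N P hN hP (fun p hp => (hk p hp).resolve_left (by simp)))
    exact GpRat.of_eventually E (fun i hi => by rw [hE i hi, sub_self])
  | cons p l ih =>
    intro N P hN hP hle hc hk
    have ih := ih (fun p hp => hl p (List.mem_cons_of_mem _ hp))
    obtain ⟨d, x⟩ := p
    obtain ⟨hd, hx⟩ := hl (d, x) List.mem_cons_self
    simp only at hd hx
    let X : A →ₗ[k] A := LinearMap.mulRight k x
    have hX : ∀ a, X a = a * x := fun a => rfl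
    have hfN : ∀ i, FiniteDimensional k (N i) := fun i =>
      Submodule.finiteDimensional_of_le (hN.1 i)
    have hfP : ∀ i, FiniteDimensional k (P i) := fun i =>
      Submodule.finiteDimensional_of_le (hP.1 i)
    have hsw : ∀ i, ∀ a ∈ N i, ∀ b, a * x * b = a * b * x := by
      intro i a ha b
      rw [mul_assoc, mul_assoc, hc i a ha]
    let K : ℕ → Submodule k A := fun i => N i ⊓ (P (i + d)).comap X
    let C : ℕ → Submodule k A := fun i => P i ⊔ (if d ≤ i then (N (i - d)).map X else ⊥)
    have hCd : ∀ i, C (i + d) = P (i + d) ⊔ (N i).map X := by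
      intro i
      simp [C]
    have hCl : ∀ i, i < d → C i = P i := by
      intro i hi
      simp [C, not_le.mpr hi]
    have hK : GpFam 𝒜 K := by
      refine ⟨fun i => inf_le_left.trans (hN.1 i), ?_⟩
      rintro i j a ⟨ha, ha'⟩ b hb
      refine ⟨hN.2 i j a ha b hb, ?_⟩
      rw [SetLike.mem_coe, Submodule.mem_comap, hX] at ha' ⊢
      rw [← hsw i a ha, add_right_comm]
      exact hP.2 _ _ _ ha' _ hb
    have hPK : ∀ i, P i ≤ K i := fun i a ha => ⟨hle i ha, hP.2 i d a ha x hx⟩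
    have hCN : ∀ i, C i ≤ N i := by
      intro i
      refine sup_le (hle i) ?_
      split_ifs with h
      · rintro _ ⟨a, ha, rfl⟩
        have := hN.2 (i - d) d a ha x hx
        rwa [Nat.sub_add_cancel h] at this
      · exact bot_le
    have hPC : ∀ i, P i ≤ C i := fun i => le_sup_left
    have hC : GpFam 𝒜 C := by
      refine ⟨fun i => (hCN i).trans (hN.1 i), ?_⟩
      intro i j a ha b hb
      rcases lt_or_ge i d with h | h
      · rw [hCl i h] at ha
        exact hPC _ (hP.2 i j a ha b hb)
      · obtain ⟨m, rfl⟩ := Nat.exists_eq_add_of_le' h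
        rw [hCd] at ha
        rw [add_right_comm, hCd]
        obtain ⟨u, hu, _, ⟨v, hv, rfl⟩, rfl⟩ := Submodule.mem_sup.mp ha
        rw [add_mul]
        refine Submodule.add_mem_sup ?_ ?_
        · rw [add_right_comm]
          exact hP.2 _ _ _ hu _ hb
        · refine ⟨v * b, hN.2 _ _ _ hv _ hb, ?_⟩
          rw [hX, hX, hsw m v hv]
    have rK := ih K P hK hP hPK (fun i a ha => hc i a ha.1) (by
      intro p hp
      rcases hk p hp with h | h
      · rcases List.mem_cons.mp h with rfl | h
        · right
          intro i a ha
          exact ha.2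
        · exact Or.inl h
      · exact Or.inr fun i a ha => h i a ha.1)
    have rC := ih N C hN hC hCN hc (by
      intro p hp
      rcases hk p hp with h | h
      · rcases List.mem_cons.mp h with rfl | h
        · right
          intro i a ha
          simp only
          rw [hCd]
          exact Submodule.mem_sup_right ⟨a, ha, rfl⟩
        · exact Or.inl h
      · exact Or.inr fun i a ha => hPC _ (h i a ha))
    refine GpRat.step d hd rC rK ?_ ?_
    · intro i hi
      show _ = (_ : ℤ)
      rw [hCl i hi]
    · intro i
      have := gp_rank X (N i) (P (i + d))
      rw [← hCd] at this
      change _ - _ = _ - (_ : ℤ)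
      simp only [K]
      linarith
end

section
variable {k A : Type*} [Field k] [Ring A] [Algebra k A] (𝒜 : ℕ → Submodule k A) [GradedAlgebra 𝒜]

/-- The family of the augmentation ideal. -/
def gpPos : ℕ → Submodule k A := fun i => if i = 0 then ⊥ else 𝒜 i

theorem gpPos_fam : GpFam 𝒜 (gpPos 𝒜) := by
  constructor
  · intro i
    simp only [gpPos]
    split_ifs
    · exact bot_le
    · exact le_rfl
  · intro i j a ha b hb
    rcases Nat.eq_zero_or_pos i with rfl | hi
    · have : a = 0 := by simpa [gpPos] using ha
      rw [this, zero_mul]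
      exact Submodule.zero_mem _
    · simp only [gpPos] at ha ⊢
      rw [if_neg (by omega)] at ha ⊢
      exact SetLike.mul_mem_graded ha hb

theorem gp_mem_pos (a : A) : a ∈ gpTot 𝒜 (gpPos 𝒜) (gpPos_fam 𝒜) ↔
    a ∈ (⨆ i ≥ 1, 𝒜 i : Submodule k A) := by
  classical
  constructor
  · intro h
    rw [← DirectSum.sum_support_decompose 𝒜 a]
    refine Submodule.sum_mem _ fun i _ => ?_
    have hi := h i
    simp only [gpPos] at hi
    split_ifs at hi with h0
    · rw [(Submodule.mem_bot k).mp hi]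
      exact Submodule.zero_mem _
    · exact Submodule.mem_iSup_of_mem i (Submodule.mem_iSup_of_mem (by omega) hi)
  · intro h
    let Q : Submodule k A :=
      { carrier := gpTot 𝒜 (gpPos 𝒜) (gpPos_fam 𝒜)
        add_mem' := fun h1 h2 => Submodule.add_mem _ h1 h2
        zero_mem' := Submodule.zero_mem _
        smul_mem' := by
          intro c x hx i
          rw [DirectSum.decompose_smul]
          exact Submodule.smul_mem _ c (hx i) }
    have hQ : (⨆ i ≥ 1, 𝒜 i : Submodule k A) ≤ Q := by
      refine iSup₂_le fun i hi x hx => ?_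
      refine (gp_mem_tot_hom 𝒜 (gpPos_fam 𝒜) hx).mpr ?_
      simp only [gpPos]
      rwa [if_neg (by omega)]
    exact hQ h

theorem gp_gen (hlf : ∀ i, FiniteDimensional k (𝒜 i)) (hfg : Algebra.FiniteType k A) :
    ∃ Sp : Finset (ℕ × A), (∀ p ∈ Sp, 1 ≤ p.1 ∧ p.2 ∈ 𝒜 p.1) ∧
      ∀ w ∈ (⨆ i ≥ 1, 𝒜 i : Submodule k A),
        w ∈ Submodule.span k {v : A | ∃ p ∈ Sp, ∃ a : A, v = p.2 * a} := by
  classical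
  obtain ⟨T, hT⟩ := hfg.out
  let D : ℕ := T.sup fun t => (DirectSum.decompose 𝒜 t).support.sup id
  have hfgi : ∀ i, (𝒜 i).FG := fun i => Module.Finite.iff_fg.mp (hlf i)
  choose s hs using hfgi
  let Sp : Finset (ℕ × A) := (Finset.Icc 1 D).biUnion fun i => (s i).image fun x => (i, x)
  have hSp : ∀ p ∈ Sp, 1 ≤ p.1 ∧ p.1 ≤ D ∧ p.2 ∈ 𝒜 p.1 := by
    intro p hp
    simp only [Sp, Finset.mem_biUnion, Finset.mem_Icc, Finset.mem_image] at hp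
    obtain ⟨i, hi, x, hx, rfl⟩ := hp
    refine ⟨hi.1, hi.2, ?_⟩
    simp only
    rw [← hs i]
    exact Submodule.subset_span hx
  refine ⟨Sp, fun p hp => ⟨(hSp p hp).1, (hSp p hp).2.2⟩, ?_⟩
  set J := Submodule.span k {v : A | ∃ p ∈ Sp, ∃ a : A, v = p.2 * a} with hJ
  have hJ1 : ∀ i, 1 ≤ i → i ≤ D → ∀ x ∈ 𝒜 i, ∀ a, x * a ∈ J := by
    intro i h1 h2 x hx a
    rw [← hs i] at hx
    induction hx using Submodule.span_induction with
    | mem x hx =>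
      refine Submodule.subset_span ⟨(i, x), ?_, a, rfl⟩
      simp only [Sp, Finset.mem_biUnion, Finset.mem_Icc, Finset.mem_image]
      exact ⟨i, ⟨h1, h2⟩, x, hx, rfl⟩
    | zero => rw [zero_mul]; exact J.zero_mem
    | add x y _ _ hx hy => rw [add_mul]; exact J.add_mem hx hy
    | smul c x _ hx => rw [smul_mul_assoc]; exact J.smul_mem c hx
  have hJr : ∀ y ∈ J, ∀ b, y * b ∈ J := by
    intro y hy b
    induction hy using Submodule.span_induction with
    | mem x hx =>
      obtain ⟨p, hp, a, rfl⟩ := hx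
      rw [mul_assoc]
      exact Submodule.subset_span ⟨p, hp, _, rfl⟩
    | zero => rw [zero_mul]; exact J.zero_mem
    | add x y _ _ hx hy => rw [add_mul]; exact J.add_mem hx hy
    | smul c x _ hx => rw [smul_mul_assoc]; exact J.smul_mem c hx
  have hJl : ∀ y ∈ J, ∀ b ∈ 𝒜 0, b * y ∈ J := by
    intro y hy b hb
    induction hy using Submodule.span_induction with
    | mem x hx =>
      obtain ⟨p, hp, a, rfl⟩ := hx
      rw [← mul_assoc]
      refine hJ1 p.1 (hSp p hp).1 (hSp p hp).2.1 _ ?_ a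
      have := SetLike.mul_mem_graded hb (hSp p hp).2.2
      rwa [zero_add] at this
    | zero => rw [mul_zero]; exact J.zero_mem
    | add x y _ _ hx hy => rw [mul_add]; exact J.add_mem hx hy
    | smul c x _ hx => rw [mul_smul_comm]; exact J.smul_mem c hx
  have h1 : (1 : A) ∈ 𝒜 0 ⊔ J := Submodule.mem_sup_left SetLike.GradedOne.one_mem
  let Q : Subalgebra k A := Submodule.toSubalgebra (𝒜 0 ⊔ J) h1 (by
    intro x y hx hy
    obtain ⟨u, hu, v, hv, rfl⟩ := Submodule.mem_sup.mp hx
    obtain ⟨u', hu', v', hv', rfl⟩ := Submodule.mem_sup.mp hy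
    have e : (u + v) * (u' + v') = u * u' + (u * v' + v * (u' + v')) := by noncomm_ring
    rw [e]
    refine Submodule.add_mem_sup ?_ (J.add_mem (hJl _ hv' _ hu) (hJr _ hv _))
    have := SetLike.mul_mem_graded hu hu'
    rwa [zero_add] at this)
  have hQ : Q = ⊤ := by
    rw [eq_top_iff, ← hT, Algebra.adjoin_le_iff]
    intro t ht
    change t ∈ 𝒜 0 ⊔ J
    rw [← DirectSum.sum_support_decompose 𝒜 t]
    refine Submodule.sum_mem _ fun i hi => ?_
    rcases Nat.eq_zero_or_pos i with rfl | h
    · exact Submodule.mem_sup_left (SetLike.coe_mem _)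
    · refine Submodule.mem_sup_right ?_
      have hiD : i ≤ D := by
        have h2 : (DirectSum.decompose 𝒜 t).support.sup id ≤ D :=
          Finset.le_sup (f := fun t => (DirectSum.decompose 𝒜 t).support.sup id) ht
        exact (Finset.le_sup (f := id) hi).trans h2
      have := hJ1 i h hiD _ (SetLike.coe_mem (DirectSum.decompose 𝒜 t i)) 1
      rwa [mul_one] at this
  intro w hw
  have hwQ : w ∈ 𝒜 0 ⊔ J := by
    change w ∈ Q
    rw [hQ]
    trivial
  obtain ⟨u, hu, v, hv, rfl⟩ := Submodule.mem_sup.mp hwQ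
  have hvM : v ∈ gpTot 𝒜 (gpPos 𝒜) (gpPos_fam 𝒜) := by
    rw [gp_mem_pos]
    have : J ≤ (⨆ i ≥ 1, 𝒜 i : Submodule k A) := by
      rw [hJ, Submodule.span_le]
      rintro _ ⟨p, hp, a, rfl⟩
      rw [SetLike.mem_coe, ← gp_mem_pos]
      refine Submodule.smul_mem _ (MulOpposite.op a) ?_
      rw [gp_mem_pos]
      exact Submodule.mem_iSup_of_mem p.1
        (Submodule.mem_iSup_of_mem (hSp p hp).1 (hSp p hp).2.2)
    exact this hv
  have huM : u ∈ gpTot 𝒜 (gpPos 𝒜) (gpPos_fam 𝒜) := by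
    have := Submodule.sub_mem _ ((gp_mem_pos 𝒜 _).mpr hw) hvM
    rwa [add_sub_cancel_right] at this
  have hu0 := (gp_mem_tot_hom 𝒜 (gpPos_fam 𝒜) hu).mp huM
  have : u = 0 := by simpa [gpPos] using hu0
  rw [this, zero_add]
  exact hv
end

/-- Let `A` be a finitely generated, locally finite GPerm algebra.  Then
`A_{≥1}` kills all commutators (so the right action of `A` on `A_{≥1}` factors
through the commutative quotient `B = A/[A,A]`), `A_{≥1}` is a finitely
generated right module (over `A`, equivalently over `B`), `A` is right
noetherian, and the Hilbert series of `A` is rational. -/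
theorem stmt16 {k A : Type*} [Field k] [Ring A] [Algebra k A]
    (𝒜 : ℕ → Submodule k A) [GradedAlgebra 𝒜]
    (hlf : ∀ i, FiniteDimensional k (𝒜 i))
    (hperm : ∀ i, 1 ≤ i → ∀ a ∈ 𝒜 i, ∀ b c : A, a * (b * c) = a * (c * b))
    (hfg : Algebra.FiniteType k A) :
    (∀ a ∈ (⨆ i ≥ 1, 𝒜 i : Submodule k A), ∀ b c : A, a * (b * c - c * b) = 0) ∧
    (∃ S : Finset A, (↑S : Set A) ⊆ (⨆ i ≥ 1, 𝒜 i : Submodule k A) ∧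
      ∀ w ∈ (⨆ i ≥ 1, 𝒜 i : Submodule k A),
        w ∈ Submodule.span k {v : A | ∃ s ∈ S, ∃ a : A, v = s * a}) ∧
    IsNoetherianRing Aᵐᵒᵖ ∧
    (∃ p q : Polynomial ℤ, q.coeff 0 = 1 ∧
      PowerSeries.mk (fun i => (Module.finrank k (𝒜 i) : ℤ)) * (q : PowerSeries ℤ)
        = (p : PowerSeries ℤ)) := by
  classical
  have part1 : ∀ a ∈ (⨆ i ≥ 1, 𝒜 i : Submodule k A), ∀ b c : A, a * (b * c - c * b) = 0 := by
    intro a ha b c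
    have h : (⨆ i ≥ 1, 𝒜 i : Submodule k A) ≤
        LinearMap.ker (LinearMap.mulRight k (b * c - c * b)) := by
      refine iSup₂_le fun i hi x hx => ?_
      rw [LinearMap.mem_ker, LinearMap.mulRight_apply, mul_sub, hperm i hi x hx, sub_self]
    exact h ha
  obtain ⟨Sp, hSp, hgen⟩ := gp_gen 𝒜 hlf hfg
  have hSpM : ∀ p ∈ Sp, p.2 ∈ (⨆ i ≥ 1, 𝒜 i : Submodule k A) := fun p hp =>
    Submodule.mem_iSup_of_mem p.1 (Submodule.mem_iSup_of_mem (hSp p hp).1 (hSp p hp).2)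
  let M := gpTot 𝒜 (gpPos 𝒜) (gpPos_fam 𝒜)
  have hMfin : Module.Finite Aᵐᵒᵖ M := by
    rw [Module.Finite.iff_fg]
    refine ⟨Sp.image Prod.snd, le_antisymm ?_ ?_⟩
    · rw [Submodule.span_le]
      intro x hx
      obtain ⟨p, hp, rfl⟩ := Finset.mem_image.mp hx
      exact (gp_mem_pos 𝒜 _).mpr (hSpM p hp)
    · intro w hw
      have hw' := hgen w ((gp_mem_pos 𝒜 w).mp hw)
      clear hw
      induction hw' using Submodule.span_induction with
      | mem x hx =>
        obtain ⟨p, hp, a, rfl⟩ := hx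
        exact Submodule.smul_mem _ (MulOpposite.op a)
          (Submodule.subset_span (Finset.mem_image_of_mem _ hp))
      | zero => exact Submodule.zero_mem _
      | add x y _ _ hx hy => exact Submodule.add_mem _ hx hy
      | smul c x _ hx =>
        have e : c • x = MulOpposite.op (algebraMap k A c) • x := by
          rw [MulOpposite.smul_eq_mul_unop, MulOpposite.unop_op, Algebra.smul_def,
            Algebra.commutes]
        rw [e]
        exact Submodule.smul_mem _ _ hx
  have hfgop : Algebra.FiniteType k Aᵐᵒᵖ := by
    obtain ⟨T, hT⟩ := hfg.out
    refine ⟨⟨T.image MulOpposite.op, ?_⟩⟩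
    rw [eq_top_iff]
    intro x _
    have hx : x.unop ∈ Algebra.adjoin k (T : Set A) := by rw [hT]; trivial
    have key : ∀ y ∈ Algebra.adjoin k (T : Set A), MulOpposite.op y ∈
        Algebra.adjoin k ((T.image MulOpposite.op : Finset Aᵐᵒᵖ) : Set Aᵐᵒᵖ) := by
      intro y hy
      induction hy using Algebra.adjoin_induction with
      | mem x hx => exact Algebra.subset_adjoin (Finset.mem_image_of_mem _ hx)
      | algebraMap r => exact Subalgebra.algebraMap_mem _ r
      | add x y _ _ hx hy => exact Subalgebra.add_mem _ hx hy
      | mul x y _ _ hx hy =>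
        rw [MulOpposite.op_mul]
        exact Subalgebra.mul_mem _ hy hx
    exact key _ hx
  have hst : IsScalarTower k Aᵐᵒᵖ A := inferInstance
  have hMn : IsNoetherian Aᵐᵒᵖ M := by
    refine gp_noeth (k := k) hfgop ?_ hMfin
    rintro a b ⟨m, hm⟩
    apply Subtype.ext
    change m * b.unop * a.unop = m * a.unop * b.unop
    have := part1 m ((gp_mem_pos 𝒜 m).mp hm) b.unop a.unop
    rw [mul_sub, sub_eq_zero] at this
    rw [mul_assoc, mul_assoc, this]
  have hQn : IsNoetherian Aᵐᵒᵖ (A ⧸ M) := by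
    have hf : Module.Finite k (A ⧸ M) := by
      have := hlf 0
      let f : 𝒜 0 →ₗ[k] A ⧸ M := (M.mkQ.restrictScalars k).comp (𝒜 0).subtype
      refine Module.Finite.of_surjective f ?_
      intro y
      obtain ⟨a, rfl⟩ := Submodule.mkQ_surjective M y
      refine ⟨DirectSum.decompose 𝒜 a 0, ?_⟩
      change M.mkQ _ = M.mkQ a
      rw [← sub_eq_zero, ← map_sub, ← LinearMap.mem_ker, Submodule.ker_mkQ]
      intro i
      rw [DirectSum.decompose_sub]
      rcases Nat.eq_zero_or_pos i with rfl | hi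
      · simp [gpPos]
      · simp only [gpPos]
        rw [if_neg (by omega)]
        exact SetLike.coe_mem _
    exact isNoetherian_of_tower k inferInstance
  have hAn : IsNoetherian Aᵐᵒᵖ A := (isNoetherian_iff_submodule_quotient M).mpr ⟨hMn, hQn⟩
  refine ⟨part1, ⟨Sp.image Prod.snd, ?_, ?_⟩, ?_, ?_⟩
  · intro x hx
    obtain ⟨p, hp, rfl⟩ := Finset.mem_image.mp hx
    exact hSpM p hp
  · intro w hw
    refine Submodule.span_mono ?_ (hgen w hw)
    rintro _ ⟨p, hp, a, rfl⟩
    exact ⟨p.2, Finset.mem_image_of_mem _ hp, a, rfl⟩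
  · let e : A ≃ₗ[Aᵐᵒᵖ] Aᵐᵒᵖ :=
      { MulOpposite.opAddEquiv with
        map_smul' := fun c x => rfl }
    exact isNoetherian_of_linearEquiv e
  · have hbot : GpFam 𝒜 (fun _ => (⊥ : Submodule k A)) := by
      refine ⟨fun i => bot_le, ?_⟩
      intro i j a ha b _
      rw [(Submodule.mem_bot k).mp ha, zero_mul]
      exact Submodule.zero_mem _
    have hr := gp_hs 𝒜 hlf hAn (Sp : Set (ℕ × A)) ?_ Sp.toList
      (fun p hp => hSp p (Finset.mem_toList.mp hp)) (gpPos 𝒜) (fun _ => ⊥) (gpPos_fam 𝒜) hbot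
      (fun _ => bot_le) ?_ (fun p hp => Or.inl (Finset.mem_toList.mpr hp))
    · have h0 : GpRat (fun i => if i = 0 then (Module.finrank k (𝒜 0) : ℤ) else 0) :=
        GpRat.of_eventually 0 (fun i hi => if_neg (by omega))
      have := hr.add h0
      refine cast (congrArg GpRat ?_) this
      funext i
      by_cases hi : i = 0
      · subst hi
        have e : gpPos 𝒜 0 = ⊥ := if_pos rfl
        rw [e, sub_self, zero_add, if_pos rfl]
      · have e : gpPos 𝒜 i = 𝒜 i := if_neg hi
        rw [e, finrank_bot, if_neg hi]
        simp
    · intro N P hN hP hk i j hj a ha b hb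
      have hb' := hgen b (Submodule.mem_iSup_of_mem j (Submodule.mem_iSup_of_mem hj hb))
      have hab : a * b ∈ gpTot 𝒜 P hP := by
        clear hb
        induction hb' using Submodule.span_induction with
        | mem x hx =>
          obtain ⟨p, hp, c, rfl⟩ := hx
          rw [← mul_assoc]
          refine Submodule.smul_mem _ (MulOpposite.op c) ?_
          have h := hk p hp i a ha
          exact (gp_mem_tot_hom 𝒜 hP (hP.1 _ h)).mpr h
        | zero => rw [mul_zero]; exact Submodule.zero_mem _
        | add x y _ _ hx hy => rw [mul_add]; exact Submodule.add_mem _ hx hy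
        | smul c x _ hx =>
          intro m
          rw [mul_smul_comm, DirectSum.decompose_smul]
          exact Submodule.smul_mem _ c (hx m)
      exact (gp_mem_tot_hom 𝒜 hP (SetLike.mul_mem_graded (hN.1 i ha) hb)).mp hab
    · intro i a ha b c
      have ha' : a ∈ gpTot 𝒜 (gpPos 𝒜) (gpPos_fam 𝒜) :=
        (gp_mem_tot_hom 𝒜 (gpPos_fam 𝒜) ((gpPos_fam 𝒜).1 i ha)).mpr ha
      have := part1 a ((gp_mem_pos 𝒜 a).mp ha') b c
      rwa [mul_sub, sub_eq_zero] at this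
end

section
/- Let P be a symmetric operad with trivial S-action on every P(n) and let A = ⊕_{i≥0} A_i with A_i = P(i+1) and product x·y := x ∘_1 y. Then A is a GPerm algebra: it is a unital ℕ-graded associative algebra and x·(y·z) = x·(z·y) for all x ∈ A_{≥1} and y, z ∈ A. -/
/-- `IsBlockPerm m n i φ σ ψ`: `ψ ∈ S_{m+n-1}` is the block permutation
`ϑ_{m;1,…,1,n,1,…,1}(φ, 1,…,1,σ,1,…,1)` (sizes `1,…,1,n,1,…,1` with the block
of size `n` at the `i`-th input, base permutation `φ ∈ S_m`, internal
permutation `σ ∈ S_n` on the big block). -/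
def IsBlockPerm (m n : ℕ) (hn : 1 ≤ n) (i : Fin m) (φ : Equiv.Perm (Fin m))
    (σ : Equiv.Perm (Fin n)) (ψ : Equiv.Perm (Fin (m + n - 1))) : Prop :=
  (∀ t : Fin m, t ≠ i →
    (ψ ⟨(t : ℕ) + (if (i : ℕ) < (t : ℕ) then n - 1 else 0),
        by have := t.isLt; have := i.isLt; split <;> omega⟩ : ℕ)
      = (φ t : ℕ) + (if (φ i : ℕ) < (φ t : ℕ) then n - 1 else 0)) ∧
  (∀ o : Fin n,
    (ψ ⟨(i : ℕ) + (o : ℕ), by have := o.isLt; have := i.isLt; omega⟩ : ℕ)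
      = (φ i : ℕ) + (σ o : ℕ))

universe u

/-- A reduced symmetric operad (of `k`-vector spaces), in the partial-composition
formulation of Definition 1.1: a sequence of `k`-modules `space n` with right
`S_n`-actions, an identity `1 ∈ space 1`, partial compositions
`∘_i : space m ⊗ space n → space (m+n-1)` (indices `0`-based), subject to
the unit axioms, the two associativity axioms E1.1.1, E1.1.2, and the
equivariance axioms E1.1.3, E1.1.4 (formulated via block permutations). -/
structure SymOperad (k : Type u) [Field k] : Type (u + 1) where
  space : ℕ → Type u
  [acg : ∀ n, AddCommGroup (space n)]
  [mod : ∀ n, Module k (space n)]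
  act : ∀ {n : ℕ}, space n → Equiv.Perm (Fin n) → space n
  act_one : ∀ {n : ℕ} (x : space n), act x 1 = x
  act_mul : ∀ {n : ℕ} (x : space n) (σ τ : Equiv.Perm (Fin n)),
    act x (σ * τ) = act (act x σ) τ
  act_add : ∀ {n : ℕ} (x y : space n) (σ : Equiv.Perm (Fin n)),
    act (x + y) σ = act x σ + act y σ
  act_smul : ∀ {n : ℕ} (c : k) (x : space n) (σ : Equiv.Perm (Fin n)),
    act (c • x) σ = c • act x σ
  one : space 1
  comp : ∀ {m n : ℕ}, Fin m → space m → space n → space (m + n - 1)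
  comp_add_left : ∀ {m n : ℕ} (i : Fin m) (x y : space m) (z : space n),
    comp i (x + y) z = comp i x z + comp i y z
  comp_add_right : ∀ {m n : ℕ} (i : Fin m) (x : space m) (y z : space n),
    comp i x (y + z) = comp i x y + comp i x z
  comp_smul_left : ∀ {m n : ℕ} (i : Fin m) (c : k) (x : space m) (z : space n),
    comp i (c • x) z = c • comp i x z
  comp_smul_right : ∀ {m n : ℕ} (i : Fin m) (c : k) (x : space m) (z : space n),
    comp i x (c • z) = c • comp i x z
  /-- `θ ∘_i 1 = θ`. -/
  comp_one : ∀ {n : ℕ} (i : Fin n) (x : space n), comp i x one = x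
  /-- `1 ∘_1 θ = θ`. -/
  one_comp : ∀ {n : ℕ} (x : space n),
    comp (0 : Fin 1) one x = cast (congrArg space (by omega : n = 1 + n - 1)) x
  /-- E1.1.1: `(λ ∘_i μ) ∘_{i-1+j} ν = λ ∘_i (μ ∘_j ν)` (0-based: index `i+j`). -/
  assoc₁ : ∀ {l m n : ℕ} (i : Fin l) (j : Fin m)
    (lam : space l) (mu : space m) (nu : space n),
    comp ⟨(i : ℕ) + (j : ℕ), by have := i.isLt; have := j.isLt; omega⟩
        (comp i lam mu) nu
      = cast (congrArg space
          (by have := i.isLt; have := j.isLt; omega :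
            l + (m + n - 1) - 1 = l + m - 1 + n - 1))
          (comp i lam (comp j mu nu))
  /-- E1.1.2: `(λ ∘_i μ) ∘_{k-1+m} ν = (λ ∘_k ν) ∘_i μ` for `i < k`
  (0-based: index `k + m - 1`). -/
  assoc₂ : ∀ {l m n : ℕ} (hm : 1 ≤ m) (hn : 1 ≤ n) (i kk : Fin l)
    (hik : (i : ℕ) < (kk : ℕ)) (lam : space l) (mu : space m) (nu : space n),
    comp ⟨(kk : ℕ) + m - 1, by have := kk.isLt; omega⟩ (comp i lam mu) nu
      = cast (congrArg space
          (by have := kk.isLt; omega : l + n - 1 + m - 1 = l + m - 1 + n - 1))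
          (comp ⟨(i : ℕ), by have := kk.isLt; omega⟩ (comp kk lam nu) mu)
  /-- E1.1.3: `μ ∘_i (ν ∗ σ) = (μ ∘_i ν) ∗ σ'`, where `σ'` is the block
  permutation of `σ`. -/
  equiv_inner : ∀ {m n : ℕ} (hn : 1 ≤ n) (i : Fin m) (x : space m) (y : space n)
    (σ : Equiv.Perm (Fin n)) (ψ : Equiv.Perm (Fin (m + n - 1))),
    IsBlockPerm m n hn i 1 σ ψ →
      comp i x (act y σ) = act (comp i x y) ψ
  /-- E1.1.4: `(μ ∗ φ) ∘_i ν = (μ ∘_{φ(i)} ν) ∗ φ''`, where `φ''` is the block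
  permutation of `φ`. -/
  equiv_outer : ∀ {m n : ℕ} (hn : 1 ≤ n) (i : Fin m) (x : space m) (y : space n)
    (φ : Equiv.Perm (Fin m)) (ψ : Equiv.Perm (Fin (m + n - 1))),
    IsBlockPerm m n hn i φ 1 ψ →
      comp i (act x φ) y = act (comp (φ i) x y) ψ

/-- The product on `A = ⊕ A_i`, `A_i = P(i+1)`: `x·y = x ∘_1 y`, recast so that
the grading is by `A_a · A_b ⊆ A_{a+b}` (`x` of arity `a+1`, `y` of arity
`b+1`, product of arity `a+b+1`). -/
def SymOperad.gmul {k : Type u} [Field k] (O : SymOperad k) {a b : ℕ}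
    (x : O.space (a + 1)) (y : O.space (b + 1)) : O.space (a + b + 1) :=
  cast (congrArg O.space (by omega : a + 1 + (b + 1) - 1 = a + b + 1))
    (O.comp (⟨0, Nat.succ_pos a⟩ : Fin (a + 1)) x y)

theorem SymOperad.comp_hcongr {k : Type u} [Field k] (O : SymOperad k) {m m' n n' : ℕ}
    (hm : m = m') (hn : n = n') {i : Fin m} {i' : Fin m'} (hi : (i : ℕ) = (i' : ℕ))
    {x : O.space m} {x' : O.space m'} (hx : HEq x x')
    {y : O.space n} {y' : O.space n'} (hy : HEq y y') :
    HEq (O.comp i x y) (O.comp i' x' y') := by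
  subst hm hn
  obtain rfl := Fin.ext hi
  obtain rfl := eq_of_heq hx
  obtain rfl := eq_of_heq hy
  rfl

theorem SymOperad.gmul_heq {k : Type u} [Field k] (O : SymOperad k) {a b : ℕ}
    (x : O.space (a + 1)) (y : O.space (b + 1)) :
    HEq (O.gmul x y) (O.comp (⟨0, Nat.succ_pos a⟩ : Fin (a + 1)) x y) :=
  cast_heq _ _

/-- The base rotation, sending the last index to `0`. -/
def rotBase (a : ℕ) : Equiv.Perm (Fin (a + 1)) where
  toFun v := ⟨if (v : ℕ) < a then v + 1 else 0, by have := v.isLt; split <;> omega⟩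
  invFun v := ⟨if (v : ℕ) = 0 then a else v - 1, by have := v.isLt; split <;> omega⟩
  left_inv v := by
    have := v.isLt
    apply Fin.ext
    dsimp only
    grind
  right_inv v := by
    have := v.isLt
    apply Fin.ext
    dsimp only
    grind

/-- The block rotation attached to `rotBase`. -/
def rotBlock (a n : ℕ) : Equiv.Perm (Fin (a + 1 + n - 1)) where
  toFun v := ⟨if (v : ℕ) < a then v + n else v - a, by have := v.isLt; split <;> omega⟩
  invFun v := ⟨if (v : ℕ) < n then v + a else v - n, by have := v.isLt; split <;> omega⟩
  left_inv v := by
    have := v.isLt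
    apply Fin.ext
    dsimp only
    grind
  right_inv v := by
    have := v.isLt
    apply Fin.ext
    dsimp only
    grind

theorem rot_isBlockPerm (a n : ℕ) (hn : 1 ≤ n) :
    IsBlockPerm (a + 1) n hn ⟨a, Nat.lt_succ_self a⟩ (rotBase a) 1 (rotBlock a n) := by
  constructor
  · intro t ht
    have h1 := t.isLt
    have h2 : (t : ℕ) ≠ a := fun h => ht (Fin.ext h)
    simp only [rotBase, rotBlock, Equiv.coe_fn_mk]
    grind
  · intro o
    simp [rotBase, rotBlock]

/-- With trivial symmetric action, first and last partial compositions agree. -/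
theorem SymOperad.comp_last_eq {k : Type u} [Field k] (O : SymOperad k)
    (htriv : ∀ (n : ℕ) (x : O.space n) (σ : Equiv.Perm (Fin n)), O.act x σ = x)
    {a n : ℕ} (hn : 1 ≤ n) (x : O.space (a + 1)) (y : O.space n) :
    O.comp ⟨a, Nat.lt_succ_self a⟩ x y = O.comp ⟨0, Nat.succ_pos a⟩ x y := by
  have h := O.equiv_outer hn ⟨a, Nat.lt_succ_self a⟩ x y (rotBase a) (rotBlock a n)
    (rot_isBlockPerm a n hn)
  rw [htriv, htriv] at h
  rw [h]
  congr 1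
  apply Fin.ext
  simp [rotBase]

theorem SymOperad.gmul_assoc {k : Type u} [Field k] (O : SymOperad k) {a b c : ℕ}
    (x : O.space (a + 1)) (y : O.space (b + 1)) (z : O.space (c + 1)) :
    HEq (O.gmul (O.gmul x y) z) (O.gmul x (O.gmul y z)) := by
  have h := O.assoc₁ ⟨0, Nat.succ_pos a⟩ ⟨0, Nat.succ_pos b⟩ x y z
  refine (O.gmul_heq _ _).trans (HEq.trans ?_ (O.gmul_heq _ _).symm)
  refine (O.comp_hcongr (by omega) rfl (by simp) (O.gmul_heq x y) HEq.rfl).trans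
    ((heq_of_eq h).trans ((cast_heq _ _).trans ?_))
  exact O.comp_hcongr rfl (by omega) rfl HEq.rfl (O.gmul_heq y z).symm

theorem SymOperad.gmul_right_comm {k : Type u} [Field k] (O : SymOperad k)
    (htriv : ∀ (n : ℕ) (x : O.space n) (σ : Equiv.Perm (Fin n)), O.act x σ = x)
    {a b c : ℕ} (ha : 1 ≤ a)
    (x : O.space (a + 1)) (y : O.space (b + 1)) (z : O.space (c + 1)) :
    HEq (O.gmul (O.gmul x y) z) (O.gmul (O.gmul x z) y) := by
  have h := O.assoc₂ (by omega : 1 ≤ b + 1) (by omega : 1 ≤ c + 1)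
    ⟨0, Nat.succ_pos a⟩ ⟨a, Nat.lt_succ_self a⟩ ha x y z
  refine (O.gmul_heq _ _).trans (HEq.trans ?_ (O.gmul_heq _ _).symm)
  rw [← O.comp_last_eq htriv (by omega) (O.gmul x y) z]
  refine (O.comp_hcongr (by omega) rfl (by simp) (O.gmul_heq x y) HEq.rfl).trans
    ((heq_of_eq h).trans ((cast_heq _ _).trans ?_))
  refine O.comp_hcongr (by omega) rfl (by simp) ?_ HEq.rfl
  rw [O.comp_last_eq htriv (by omega) x z]
  exact (O.gmul_heq x z).symm

/-- Let `P` be a symmetric operad with trivial `S`-action and let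
`A = ⊕_{i≥0} A_i` with `A_i = P(i+1)` and product `x·y = x ∘_1 y`.  Then `A` is
a GPerm algebra: it is a unital ℕ-graded associative algebra (with unit
`1_P ∈ A_0`) and `x·(y·z) = x·(z·y)` whenever `x` has positive degree
(the equalities of elements in different-but-equal graded components are stated
as `HEq`). -/
theorem stmt18 {k : Type u} [Field k] (O : SymOperad k)
    (htriv : ∀ (n : ℕ) (x : O.space n) (σ : Equiv.Perm (Fin n)), O.act x σ = x) :
    (∀ (a b c : ℕ) (x : O.space (a + 1)) (y : O.space (b + 1))
        (z : O.space (c + 1)),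
      HEq (O.gmul (O.gmul x y) z) (O.gmul x (O.gmul y z))) ∧
    (∀ (a : ℕ) (x : O.space (a + 1)), O.gmul x (O.one : O.space (0 + 1)) = x) ∧
    (∀ (a : ℕ) (x : O.space (a + 1)),
      HEq (O.gmul (O.one : O.space (0 + 1)) x) x) ∧
    (∀ (a b c : ℕ), 1 ≤ a → ∀ (x : O.space (a + 1)) (y : O.space (b + 1))
        (z : O.space (c + 1)),
      HEq (O.gmul x (O.gmul y z)) (O.gmul x (O.gmul z y))) := by
  refine ⟨fun a b c x y z => O.gmul_assoc x y z, fun a x => ?_, fun a x => ?_,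
    fun a b c ha x y z => ?_⟩
  · exact eq_of_heq ((O.gmul_heq _ _).trans (heq_of_eq (O.comp_one _ x)))
  · exact (O.gmul_heq _ _).trans ((heq_of_eq (O.one_comp x)).trans (cast_heq _ _))
  · exact (O.gmul_assoc x y z).symm.trans
      ((O.gmul_right_comm htriv ha x y z).trans (O.gmul_assoc x z y))
end
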